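/- Let (A,R) be a confluent context-free monadic string rewriting system and let M be the monoid presented by ⟨A | R⟩. Then the language M(A*) = { u #₁ v #₂ wʳᵉᵛ : u, v, w ∈ A*, uv =_M w } (where #₁, #₂ are new symbols not in A and wʳᵉᵛ denotes the reverse of w) is context-free; that is, (A*, M(A*)) is a word-hyperbolic structure for M. -/

import Mathlib

/-!
Statement 0: Any monoid presented by a confluent context-free monadic string
rewriting system is word-hyperbolic: the language
`M(A*) = { u #₁ v #₂ wʳᵉᵛ : u, v, w ∈ A*, uv =_M w }` is context-free.
-/

/-- Words over the alphabet `A`. -/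
abbrev Word (A : Type) : Type := List A

/-- The word (of length at most one) corresponding to an element of `A ∪ {ε}`. -/
def toWord {A : Type} (a : Option A) : Word A := a.elim [] (fun b => [b])

/-- One rewriting step of the string rewriting system `R`. -/
def RWStep {A : Type} (R : Set (Word A × Word A)) (u v : Word A) : Prop :=
  ∃ (x y l r : Word A), (l, r) ∈ R ∧ u = x ++ l ++ y ∧ v = x ++ r ++ y

/-- The reduction relation `⇒*_R`: reflexive-transitive closure of `⇒_R`. -/
abbrev RWDerives {A : Type} (R : Set (Word A × Word A)) : Word A → Word A → Prop :=
  Relation.ReflTransGen (RWStep R)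

/-- Equality `u =_M v` in the monoid presented by `⟨A | R⟩`, i.e. the congruence
on `A*` generated by `R` (the equivalence closure of the context-closed step relation). -/
abbrev MonEq {A : Type} (R : Set (Word A × Word A)) : Word A → Word A → Prop :=
  Relation.EqvGen (RWStep R)

/-- The rewriting system `R` is confluent. -/
def RWConfluent {A : Type} (R : Set (Word A × Word A)) : Prop :=
  ∀ u u' u'' : Word A, RWDerives R u u' → RWDerives R u u'' →
    ∃ v : Word A, RWDerives R u' v ∧ RWDerives R u'' v

/-- The rewriting system `R` is monadic: length-reducing with right-hand sides
in `A ∪ {ε}`. -/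
def RWMonadic {A : Type} (R : Set (Word A × Word A)) : Prop :=
  ∀ p ∈ R, p.2.length < p.1.length ∧ p.2.length ≤ 1

/-- A monadic rewriting system is context-free if for each `a ∈ A ∪ {ε}` the set of
left-hand sides of rules with right-hand side `a` is a context-free language. -/
def RWContextFree {A : Type} (R : Set (Word A × Word A)) : Prop :=
  ∀ a : Option A, Language.IsContextFree {l : Word A | (l, toWord a) ∈ R}

/-- The alphabet `A ∪ {#₁, #₂}`. -/
inductive Hash (A : Type) : Type
  | letter : A → Hash A
  | h1 : Hash A
  | h2 : Hash A

/-- The multiplication language `M(A*) = { u #₁ v #₂ wʳᵉᵛ : u,v,w ∈ A*, uv =_M w }`. -/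
def multTable {A : Type} (R : Set (Word A × Word A)) : Language (Hash A) :=
  { x | ∃ u v w : Word A,
      x = u.map Hash.letter ++ [Hash.h1] ++ v.map Hash.letter ++ [Hash.h2]
            ++ (w.map Hash.letter).reverse ∧
      MonEq R (u ++ v) w }

/-- If `x ++ y = a ++ σ :: b`, then the distinguished entry `σ` lies in `y` or in `x`. -/
theorem List.append_eq_append_cons_cases {α : Type*} {x y a b : List α} {σ : α}
    (h : x ++ y = a ++ σ :: b) :
    (∃ c, a = x ++ c ∧ y = c ++ σ :: b) ∨ ∃ c, x = a ++ σ :: c ∧ b = c ++ y := by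
  rcases List.append_eq_append_iff.1 h with ⟨c, rfl, hc⟩ | ⟨_ | ⟨τ, c⟩, rfl, hc⟩
  · exact Or.inl ⟨c, rfl, hc⟩
  · exact Or.inl ⟨[], by simp, by simpa using hc.symm⟩
  · simp only [List.cons_append, List.cons.injEq] at hc
    obtain ⟨rfl, rfl⟩ := hc
    exact Or.inr ⟨c, rfl, rfl⟩

namespace ContextFreeGrammar

/-- The language of a symbol when nonterminals are interpreted by `F`. -/
def symbolSem {T N : Type} (F : N → Language T) : Symbol T N → Language T
  | .terminal t => ({[t]} : Set (List T))
  | .nonterminal n => F n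

/-- The language of a sentential form when nonterminals are interpreted by `F`. -/
def sem {T N : Type} (F : N → Language T) (s : List (Symbol T N)) : Language T :=
  (s.map (symbolSem F)).prod

section Sem

variable {T N : Type} (F : N → Language T)

theorem mem_sem_nil {w : List T} : w ∈ sem F [] ↔ w = [] := by
  simp [sem, Language.mem_one]

theorem mem_sem_cons {σ : Symbol T N} {s : List (Symbol T N)} {w : List T} :
    w ∈ sem F (σ :: s) ↔ ∃ x ∈ symbolSem F σ, ∃ y ∈ sem F s, x ++ y = w := by
  simp [sem, Language.mem_mul]

theorem mem_sem_append {s t : List (Symbol T N)} {w : List T} :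
    w ∈ sem F (s ++ t) ↔ ∃ x ∈ sem F s, ∃ y ∈ sem F t, x ++ y = w := by
  simp [sem, Language.mem_mul]

theorem mem_sem_singleton {σ : Symbol T N} {w : List T} :
    w ∈ sem F [σ] ↔ w ∈ symbolSem F σ := by
  simp [sem]

theorem mem_symbolSem_terminal {t : T} {w : List T} :
    w ∈ symbolSem F (.terminal t) ↔ w = [t] := Iff.rfl

theorem mem_symbolSem_nonterminal {n : N} {w : List T} :
    w ∈ symbolSem F (.nonterminal n) ↔ w ∈ F n := Iff.rfl

theorem mem_sem_map_terminal {v w : List T} :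
    w ∈ sem F (v.map Symbol.terminal) ↔ w = v := by
  induction v generalizing w with
  | nil => simp [mem_sem_nil]
  | cons a v ih => simp [mem_sem_cons, mem_symbolSem_terminal, ih, eq_comm]

end Sem

/-- An interpretation closed under the rules contains everything the grammar derives. -/
theorem Derives.mem_sem {T : Type} {g : ContextFreeGrammar T} {F : g.NT → Language T}
    (hF : ∀ r ∈ g.rules, ∀ w ∈ sem F r.output, w ∈ F r.input)
    {s : List (Symbol T g.NT)} {w : List T} (h : g.Derives s (w.map Symbol.terminal)) :
    w ∈ sem F s := by
  induction h using Relation.ReflTransGen.head_induction_on with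
  | refl => exact (mem_sem_map_terminal F).2 rfl
  | head hstep _ ih =>
    obtain ⟨r, hr, hrw⟩ := hstep
    obtain ⟨p, q, rfl, rfl⟩ := hrw.exists_parts
    simp only [mem_sem_append, mem_sem_singleton, mem_symbolSem_nonterminal] at ih ⊢
    obtain ⟨x, ⟨x₁, h₁, x₂, h₂, rfl⟩, y, hy, rfl⟩ := ih
    exact ⟨_, ⟨x₁, h₁, x₂, hF r hr _ h₂, rfl⟩, y, hy, rfl⟩

theorem derives_of_mem_rules {T : Type} {g : ContextFreeGrammar T}
    {r : ContextFreeRule T g.NT} (hr : r ∈ g.rules) :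
    g.Derives [.nonterminal r.input] r.output :=
  Relation.ReflTransGen.single ⟨r, hr, .input_output⟩

theorem Derives.context {T : Type} {g : ContextFreeGrammar T} {s s' u v : List (Symbol T g.NT)}
    (h : g.Derives s s') (p q : List (Symbol T g.NT)) (hu : u = p ++ (s ++ q))
    (hv : v = p ++ (s' ++ q)) : g.Derives u v := by
  subst hu hv
  exact (h.append_right q).append_left p

theorem Derives.append {T : Type} {g : ContextFreeGrammar T}
    {s s' t t' : List (Symbol T g.NT)} (hs : g.Derives s s') (ht : g.Derives t t') :
    g.Derives (s ++ t) (s' ++ t') :=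
  (Derives.append_right hs t).trans (Derives.append_left ht s')

/-! ### Replacing one distinguished letter -/

section Pointed

variable {T T' : Type} (g : ContextFreeGrammar T) (h : T → T') (φ : T → Option (List T'))

/-- The unpointed copy of a symbol. -/
def plainSymbol {N : Type} : Symbol T N → Symbol T' (N × Bool)
  | .terminal t => .terminal (h t)
  | .nonterminal n => .nonterminal (n, false)

/-- The sentential form standing for a symbol that contains the distinguished letter. -/
inductive PointedSymbol {N : Type} : Symbol T N → List (Symbol T' (N × Bool)) → Prop
  | terminal {t : T} {x : List T'} (hx : φ t = some x) :
      PointedSymbol (.terminal t) (x.map Symbol.terminal)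
  | nonterminal (n : N) : PointedSymbol (.nonterminal n) [.nonterminal (n, true)]

/-- `Pointed h φ s s'` says that `s'` arises from `s` by choosing one symbol of `s` to contain the
distinguished letter. -/
def Pointed {N : Type} (s : List (Symbol T N)) (s' : List (Symbol T' (N × Bool))) : Prop :=
  ∃ p σ q x, s = p ++ [σ] ++ q ∧ PointedSymbol φ σ x ∧
    s' = p.map (plainSymbol h) ++ x ++ q.map (plainSymbol h)

theorem PointedSymbol.unique {N : Type} {σ : Symbol T N} {x y : List (Symbol T' (N × Bool))}
    (hx : PointedSymbol φ σ x) (hy : PointedSymbol φ σ y) : x = y := by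
  cases hx <;> cases hy <;> simp_all

theorem finite_pointed {N : Type} (s : List (Symbol T N)) : {s' | Pointed h φ s s'}.Finite := by
  induction s with
  | nil =>
    convert Set.finite_empty
    ext s'
    simp [Pointed]
  | cons σ s ih =>
    have hfin : {x | PointedSymbol φ σ x}.Finite :=
      Set.Subsingleton.finite fun x hx y hy => PointedSymbol.unique φ hx hy
    refine ((ih.image (plainSymbol h σ :: ·)).union
      (hfin.image (· ++ s.map (plainSymbol h)))).subset ?_
    rintro _ ⟨_ | ⟨τ, p⟩, σ', q, x, hs, hx, rfl⟩
    · simp only [List.nil_append, List.singleton_append, List.cons.injEq] at hs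
      obtain ⟨rfl, rfl⟩ := hs
      exact Or.inr ⟨x, hx, by simp⟩
    · simp only [List.cons_append, List.cons.injEq] at hs
      obtain ⟨rfl, rfl⟩ := hs
      exact Or.inl ⟨_, ⟨p, σ', q, x, rfl, hx, rfl⟩, by simp⟩

/-- The rules of the grammar that replaces one distinguished letter. -/
def pointedRules : Set (ContextFreeRule T' (g.NT × Bool)) :=
  ⋃ r ∈ g.rules, insert ⟨(r.input, false), r.output.map (plainSymbol h)⟩
    ((fun s' => ⟨(r.input, true), s'⟩) '' {s' | Pointed h φ r.output s'})

theorem finite_pointedRules : (pointedRules g h φ).Finite :=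
  g.rules.finite_toSet.biUnion fun _ _ => ((finite_pointed h φ _).image _).insert _

/-- The grammar that replaces one distinguished letter by its image under `φ` and all other
letters by their image under `h`. -/
noncomputable abbrev pointed : ContextFreeGrammar T' where
  NT := g.NT × Bool
  initial := (g.initial, true)
  rules := (finite_pointedRules g h φ).toFinset

variable {g}

theorem plain_mem_rules {r : ContextFreeRule T g.NT} (hr : r ∈ g.rules) :
    (⟨(r.input, false), r.output.map (plainSymbol h)⟩ : ContextFreeRule T' (g.NT × Bool)) ∈
      (pointed g h φ).rules :=
  (Set.Finite.mem_toFinset _).2 (Set.mem_biUnion hr (Set.mem_insert _ _))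

theorem pointed_mem_rules {r : ContextFreeRule T g.NT} (hr : r ∈ g.rules)
    {s' : List (Symbol T' (g.NT × Bool))} (hs : Pointed h φ r.output s') :
    (⟨(r.input, true), s'⟩ : ContextFreeRule T' (g.NT × Bool)) ∈ (pointed g h φ).rules :=
  (Set.Finite.mem_toFinset _).2 (Set.mem_biUnion hr (Set.mem_insert_of_mem _ ⟨s', hs, rfl⟩))

theorem Produces.exists_pointed {s t : List (Symbol T g.NT)} (hst : g.Produces s t)
    {t' : List (Symbol T' (g.NT × Bool))} (ht : Pointed h φ t t') :
    ∃ s', Pointed h φ s s' ∧ (pointed g h φ).Derives s' t' := by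
  obtain ⟨r, hr, hrw⟩ := hst
  obtain ⟨p, q, rfl, rfl⟩ := hrw.exists_parts
  obtain ⟨a, σ, b, x, hab, hx, rfl⟩ := ht
  have hplain := derives_of_mem_rules (plain_mem_rules h φ hr)
  rw [List.append_assoc, List.append_assoc, List.singleton_append] at hab
  rcases List.append_eq_append_cons_cases hab with ⟨c, rfl, hc⟩ | ⟨c, rfl, rfl⟩
  · rcases List.append_eq_append_cons_cases hc with ⟨d, rfl, rfl⟩ | ⟨d, hd, rfl⟩
    · refine ⟨_, ⟨p ++ [.nonterminal r.input] ++ d, σ, b, x, by simp, hx, rfl⟩, ?_⟩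
      exact hplain.context (p.map (plainSymbol h))
        (d.map (plainSymbol h) ++ x ++ b.map (plainSymbol h)) (by simp [plainSymbol]) (by simp)
    · refine ⟨_, ⟨p, .nonterminal r.input, q, _, rfl, .nonterminal _, rfl⟩, ?_⟩
      have hpt := derives_of_mem_rules (pointed_mem_rules h φ hr
        ⟨c, σ, d, x, by simpa using hd, hx, rfl⟩)
      exact hpt.context (p.map (plainSymbol h)) (q.map (plainSymbol h)) (by simp) (by simp)
  · refine ⟨_, ⟨a, σ, c ++ [.nonterminal r.input] ++ q, x, by simp, hx, rfl⟩, ?_⟩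
    exact hplain.context (a.map (plainSymbol h) ++ x ++ c.map (plainSymbol h))
      (q.map (plainSymbol h)) (by simp [plainSymbol]) (by simp)

theorem Derives.exists_pointed {s t : List (Symbol T g.NT)} (hst : g.Derives s t)
    {t' : List (Symbol T' (g.NT × Bool))} (ht : Pointed h φ t t') :
    ∃ s', Pointed h φ s s' ∧ (pointed g h φ).Derives s' t' := by
  induction hst using Relation.ReflTransGen.head_induction_on with
  | refl => exact ⟨t', ht, Derives.refl _⟩
  | head hstep _ ih =>
    obtain ⟨s₁, hs₁, hd₁⟩ := ih
    obtain ⟨s₂, hs₂, hd₂⟩ := hstep.exists_pointed h φ hs₁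
    exact ⟨s₂, hs₂, hd₂.trans hd₁⟩

/-- The words obtained from words of a set by replacing one distinguished letter. -/
def pointedWords (L : Set (List T)) : Set (List T') :=
  {w | ∃ u t v x, u ++ [t] ++ v ∈ L ∧ φ t = some x ∧ w = u.map h ++ x ++ v.map h}

/-- The intended interpretation of the nonterminals of `pointed g h φ`. -/
def pointedSem : g.NT × Bool → Language T'
  | (n, false) => List.map h '' {w | g.Derives [.nonterminal n] (w.map Symbol.terminal)}
  | (n, true) => pointedWords h φ {w | g.Derives [.nonterminal n] (w.map Symbol.terminal)}

theorem mem_sem_plain {s : List (Symbol T g.NT)} {w : List T'}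
    (hw : w ∈ sem (pointedSem (g := g) h φ) (s.map (plainSymbol h))) :
    ∃ v : List T, g.Derives s (v.map Symbol.terminal) ∧ v.map h = w := by
  induction s generalizing w with
  | nil => exact ⟨[], Derives.refl _, by simpa [mem_sem_nil, eq_comm] using hw⟩
  | cons σ s ih =>
    obtain ⟨x, hx, y, hy, rfl⟩ := (mem_sem_cons _).1 hw
    obtain ⟨v, hv, rfl⟩ := ih hy
    cases σ with
    | terminal t =>
      cases hx
      exact ⟨t :: v, by simpa using hv.append_left [.terminal t], by simp⟩
    | nonterminal n =>
      obtain ⟨u, hu, rfl⟩ := hx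
      exact ⟨u ++ v, by simpa using Derives.append hu hv, by simp⟩

theorem mem_sem_pointed {s : List (Symbol T g.NT)} {s' : List (Symbol T' (g.NT × Bool))}
    (hs : Pointed h φ s s') {w : List T'} (hw : w ∈ sem (pointedSem (g := g) h φ) s') :
    w ∈ pointedWords h φ {w | g.Derives s (w.map Symbol.terminal)} := by
  obtain ⟨p, σ, q, x, rfl, hx, rfl⟩ := hs
  obtain ⟨y, hy, y₃, h₃, rfl⟩ := (mem_sem_append _).1 hw
  obtain ⟨y₁, h₁, y₂, h₂, rfl⟩ := (mem_sem_append _).1 hy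
  obtain ⟨v₁, hv₁, rfl⟩ := mem_sem_plain h φ h₁
  obtain ⟨v₃, hv₃, rfl⟩ := mem_sem_plain h φ h₃
  cases hx with
  | @terminal t x hx =>
    obtain rfl := (mem_sem_map_terminal _).1 h₂
    exact ⟨v₁, t, v₃, y₂, by simpa using (hv₁.append (Derives.refl [.terminal t])).append hv₃,
      hx, rfl⟩
  | nonterminal n =>
    obtain ⟨u, t, v, x, huv, hx, rfl⟩ := (mem_sem_singleton _).1 h₂
    exact ⟨v₁ ++ u, t, v ++ v₃, x, by simpa using (hv₁.append huv).append hv₃, hx, by simp⟩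

theorem language_pointed : (pointed g h φ).language = pointedWords h φ g.language := by
  ext w
  constructor
  · intro hw
    refine (mem_sem_singleton _).1 (Derives.mem_sem (F := pointedSem (g := g) h φ) ?_ hw)
    intro r hr w hw
    obtain ⟨r₀, hr₀, hr⟩ := Set.mem_iUnion₂.1 ((Set.Finite.mem_toFinset _).1 hr)
    rcases hr with rfl | ⟨s', hs', rfl⟩
    · obtain ⟨v, hv, rfl⟩ := mem_sem_plain h φ hw
      exact ⟨v, (derives_of_mem_rules hr₀).trans hv, rfl⟩
    · obtain ⟨u, t, v, x, huv, hx, rfl⟩ := mem_sem_pointed h φ hs' hw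
      exact ⟨u, t, v, x, (derives_of_mem_rules hr₀).trans huv, hx, rfl⟩
  · rintro ⟨u, t, v, x, huv, hx, rfl⟩
    obtain ⟨s', ⟨p, σ, q, y, hs, hy, rfl⟩, hd⟩ := Derives.exists_pointed h φ huv
      ⟨u.map Symbol.terminal, .terminal t, v.map Symbol.terminal, _, by simp, .terminal hx, rfl⟩
    obtain ⟨rfl, rfl, rfl⟩ : p = [] ∧ σ = .nonterminal g.initial ∧ q = [] := by
      rcases p with _ | ⟨_, p⟩ <;> simp_all
    cases hy
    simpa [Function.comp_def, plainSymbol, mem_language_iff] using hd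

end Pointed

end ContextFreeGrammar

/-- Context-free languages are closed under replacing one distinguished letter `t` by `φ t`. -/
theorem Language.IsContextFree.pointedWords {T T' : Type} {L : Language T} (hL : L.IsContextFree)
    (h : T → T') (φ : T → Option (List T')) :
    Language.IsContextFree (ContextFreeGrammar.pointedWords h φ L : Language T') := by
  obtain ⟨g, rfl⟩ := hL
  exact ⟨_, ContextFreeGrammar.language_pointed h φ⟩

/-! ### The grammar of pairs of words with a common reduct -/

/-- `orient false` is the identity and `orient true` is reversal. -/
def orient {α : Type} (s : Bool) (l : List α) : List α := if s then l.reverse else l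

theorem map_orient {α β : Type} (f : α → β) (s : Bool) (l : List α) :
    (orient s l).map f = orient s (l.map f) := by
  cases s <;> simp [orient]

theorem orient_nil {α : Type} (s : Bool) : orient s ([] : List α) = [] := by
  cases s <;> simp [orient]

theorem orient_singleton {α : Type} (s : Bool) (a : α) : orient s [a] = [a] := by
  cases s <;> simp [orient]

section Reduction

variable {A : Type} {R : Set (Word A × Word A)}

theorem RWStep.context {u v : Word A} (h : RWStep R u v) (p q : Word A) :
    RWStep R (p ++ u ++ q) (p ++ v ++ q) := by
  obtain ⟨x, y, l, r, hlr, rfl, rfl⟩ := h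
  exact ⟨p ++ x, y ++ q, l, r, hlr, by simp, by simp⟩

theorem rwDerives_context {u v : Word A} (h : RWDerives R u v) (p q : Word A) :
    RWDerives R (p ++ u ++ q) (p ++ v ++ q) :=
  h.lift (fun u => p ++ u ++ q) fun _ _ h => RWStep.context h p q

theorem rwDerives_append {u u' v v' : Word A} (hu : RWDerives R u u') (hv : RWDerives R v v') :
    RWDerives R (u ++ v) (u' ++ v') := by
  have h₁ := rwDerives_context hu [] v
  have h₂ := rwDerives_context hv u' []
  simp only [List.append_nil, List.nil_append] at h₁ h₂
  exact h₁.trans h₂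

theorem rwDerives_of_mem {l r : Word A} (h : (l, r) ∈ R) : RWDerives R l r :=
  .single ⟨[], [], l, r, h, by simp, by simp⟩

theorem RWConfluent.exists_of_monEq (hR : RWConfluent R) {u v : Word A} (h : MonEq R u v) :
    ∃ z, RWDerives R u z ∧ RWDerives R v z := by
  induction h with
  | rel u v h => exact ⟨v, .single h, .refl⟩
  | refl u => exact ⟨u, .refl, .refl⟩
  | symm u v _ ih => exact ih.imp fun _ h => h.symm
  | trans u v w _ _ ih₁ ih₂ =>
    obtain ⟨z₁, hu, hv⟩ := ih₁
    obtain ⟨z₂, hv', hw⟩ := ih₂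
    obtain ⟨z, hz₁, hz₂⟩ := hR v z₁ z₂ hv hv'
    exact ⟨z, hu.trans hz₁, hw.trans hz₂⟩

theorem monEq_of_rwDerives {u v : Word A} (h : RWDerives R u v) : MonEq R u v := by
  induction h with
  | refl => exact .refl _
  | tail _ h ih => exact ih.trans _ _ _ (.rel _ _ h)

theorem RWConfluent.monEq_iff (hR : RWConfluent R) {u v : Word A} :
    MonEq R u v ↔ ∃ z, RWDerives R u z ∧ RWDerives R v z :=
  ⟨hR.exists_of_monEq, fun ⟨_, hu, hv⟩ =>
    (monEq_of_rwDerives hu).trans _ _ _ (monEq_of_rwDerives hv).symm⟩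

end Reduction

/-- A word over `A` written on side `s` of a separator: the right-hand side is mirrored. -/
def sideWord {A : Type} (s : Bool) (p : Word A) : List (Option (Bool × A)) :=
  orient s (p.map fun a => some (s, a))

/-- Pairs of words with a common reduct, the second word being mirrored and the two words being
separated by `none`. -/
def commonReductLanguage {A : Type} (R : Set (Word A × Word A)) : Language (Option (Bool × A)) :=
  {x | ∃ p q z, x = sideWord false p ++ [none] ++ sideWord true q ∧
    RWDerives R p z ∧ RWDerives R q z}

/-- Nonterminals of the grammar for `commonReductLanguage`. -/
inductive PairNT {A : Type} (g : Option A → ContextFreeGrammar A) : Type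
  /-- the pairs of words -/
  | start : PairNT g
  /-- the words on side `s` reducing to `toWord a` -/
  | reducts (s : Bool) (a : Option A) : PairNT g
  /-- the words on side `s` reducing to a word generated by the nonterminal `n` of `g a` -/
  | inner (s : Bool) (a : Option A) (n : (g a).NT) : PairNT g

namespace PairNT

open ContextFreeGrammar

variable {A : Type} {g : Option A → ContextFreeGrammar A}

/-- Sentential form for the words reducing to a word over `A ∪ {ε}`. -/
def reductForm (g : Option A → ContextFreeGrammar A) (s : Bool) (z : List (Option A)) :
    List (Symbol (Option (Bool × A)) (PairNT g)) :=
  orient s (z.map fun a => .nonterminal (.reducts s a))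

/-- The symbol for words on side `s` reducing to a word generated by a symbol of `g a`. -/
def innerSymbol (s : Bool) (a : Option A) :
    Symbol A (g a).NT → Symbol (Option (Bool × A)) (PairNT g)
  | .terminal b => .nonterminal (.reducts s (some b))
  | .nonterminal n => .nonterminal (.inner s a n)

/-- Rules of the grammar for `commonReductLanguage`. -/
inductive Rule (g : Option A → ContextFreeGrammar A) :
    ContextFreeRule (Option (Bool × A)) (PairNT g) → Prop
  | wrap (a : Option A) : Rule g ⟨.start, [.nonterminal (.reducts false a),
      .nonterminal .start, .nonterminal (.reducts true a)]⟩
  | sep : Rule g ⟨.start, [.terminal none]⟩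
  | leaf (s : Bool) (a : Option A) :
      Rule g ⟨.reducts s a, (sideWord s (toWord a)).map Symbol.terminal⟩
  | insert (s : Bool) (a : Option A) : Rule g ⟨.reducts s a, reductForm g s [a, none]⟩
  | enter (s : Bool) (a : Option A) :
      Rule g ⟨.reducts s a, [.nonterminal (.inner s a (g a).initial)]⟩
  | inner (s : Bool) (a : Option A) (r : ContextFreeRule A (g a).NT) (hr : r ∈ (g a).rules) :
      Rule g ⟨.inner s a r.input, orient s (r.output.map (innerSymbol s a))⟩

theorem finite_rule [Finite A] (g : Option A → ContextFreeGrammar A) : {r | Rule g r}.Finite := by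
  have h₁ := Set.finite_range fun a : Option A =>
    (⟨.start, [.nonterminal (.reducts false a), .nonterminal .start,
      .nonterminal (.reducts true a)]⟩ : ContextFreeRule (Option (Bool × A)) (PairNT g))
  have h₂ := Set.finite_singleton
    (⟨.start, [.terminal none]⟩ : ContextFreeRule (Option (Bool × A)) (PairNT g))
  have h₃ := Set.finite_range fun i : Bool × Option A =>
    (⟨.reducts i.1 i.2, (sideWord i.1 (toWord i.2)).map Symbol.terminal⟩ :
      ContextFreeRule (Option (Bool × A)) (PairNT g))
  have h₄ := Set.finite_range fun i : Bool × Option A =>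
    (⟨.reducts i.1 i.2, reductForm g i.1 [i.2, none]⟩ :
      ContextFreeRule (Option (Bool × A)) (PairNT g))
  have h₅ := Set.finite_range fun i : Bool × Option A =>
    (⟨.reducts i.1 i.2, [.nonterminal (.inner i.1 i.2 (g i.2).initial)]⟩ :
      ContextFreeRule (Option (Bool × A)) (PairNT g))
  have h₆ := Set.finite_range fun i : Bool × Σ a : Option A, {r // r ∈ (g a).rules} =>
    (⟨.inner i.1 i.2.1 i.2.2.1.input,
      orient i.1 (i.2.2.1.output.map (innerSymbol i.1 i.2.1))⟩ :
      ContextFreeRule (Option (Bool × A)) (PairNT g))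
  refine (((((h₁.union h₂).union h₃).union h₄).union h₅).union h₆).subset ?_
  rintro _ (a | _ | ⟨s, a⟩ | ⟨s, a⟩ | ⟨s, a⟩ | ⟨s, a, r, hr⟩)
  · exact .inl (.inl (.inl (.inl (.inl ⟨a, rfl⟩))))
  · exact .inl (.inl (.inl (.inl (.inr rfl))))
  · exact .inl (.inl (.inl (.inr ⟨(s, a), rfl⟩)))
  · exact .inl (.inl (.inr ⟨(s, a), rfl⟩))
  · exact .inl (.inr ⟨(s, a), rfl⟩)
  · exact .inr ⟨(s, ⟨a, r, hr⟩), rfl⟩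

/-- The grammar for `commonReductLanguage`. -/
noncomputable abbrev grammar [Finite A] (g : Option A → ContextFreeGrammar A) :
    ContextFreeGrammar (Option (Bool × A)) where
  NT := PairNT g
  initial := .start
  rules := (finite_rule g).toFinset

section Complete

variable [Finite A]

theorem Rule.derives {r : ContextFreeRule (Option (Bool × A)) (PairNT g)} (hr : Rule g r) :
    (grammar g).Derives [.nonterminal r.input] r.output :=
  derives_of_mem_rules (g := grammar g) ((Set.Finite.mem_toFinset _).2 hr)

theorem derives_orient {s : Bool} {u v : List (Symbol (Option (Bool × A)) (PairNT g))}
    (h : (grammar g).Derives (orient s u) (orient s v))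
    (p q : List (Symbol (Option (Bool × A)) (PairNT g))) :
    (grammar g).Derives (orient s (p ++ u ++ q)) (orient s (p ++ v ++ q)) := by
  cases s
  · exact h.context p q (by simp [orient]) (by simp [orient])
  · exact h.context q.reverse p.reverse (by simp [orient]) (by simp [orient])

theorem derives_reductForm {s : Bool} {u v : List (Option A)}
    (h : (grammar g).Derives (reductForm g s u) (reductForm g s v)) (p q : List (Option A)) :
    (grammar g).Derives (reductForm g s (p ++ u ++ q)) (reductForm g s (p ++ v ++ q)) := by
  simpa [reductForm] using derives_orient h (p.map _) (q.map _)

theorem derives_inner {s : Bool} {a : Option A} {u v : List (Symbol A (g a).NT)}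
    (h : (g a).Derives u v) :
    (grammar g).Derives (orient s (u.map (innerSymbol s a)))
      (orient s (v.map (innerSymbol s a))) := by
  induction h with
  | refl => exact Derives.refl _
  | tail _ hstep ih =>
    obtain ⟨r, hr, hrw⟩ := hstep
    obtain ⟨p, q, rfl, rfl⟩ := hrw.exists_parts
    refine ih.trans ?_
    have := (Rule.inner s a r hr).derives
    rw [← orient_singleton s] at this
    simpa [innerSymbol] using
      derives_orient this (p.map (innerSymbol s a)) (q.map (innerSymbol s a))

variable {R : Set (Word A × Word A)}

theorem derives_lhs (hg : ∀ a, (g a).language = {l | (l, toWord a) ∈ R}) (s : Bool)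
    {a : Option A} {l : Word A} (h : (l, toWord a) ∈ R) :
    (grammar g).Derives (reductForm g s [a]) (reductForm g s (l.map some)) := by
  have hl : l ∈ (g a).language := by rw [hg]; exact h
  have h₁ := (Rule.enter s a).derives (g := g)
  have h₂ := derives_inner (s := s) hl
  simp only [List.map_cons, List.map_nil, orient_singleton] at h₂
  have := h₁.trans h₂
  simpa [reductForm, orient_singleton, innerSymbol, Function.comp_def] using this

theorem derives_insert_none (s : Bool) {o : List (Option A)} (ho : o ≠ []) (o' : List (Option A)) :
    (grammar g).Derives (reductForm g s (o ++ o')) (reductForm g s (o ++ [none] ++ o')) := by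
  obtain ⟨o, a, rfl⟩ := o.eq_nil_or_concat.resolve_left ho
  have h := (Rule.insert s a).derives (g := g)
  have := derives_reductForm (s := s) (u := [a]) (v := [a, none])
    (by simpa [reductForm, orient_singleton] using h) o o'
  simpa using this

theorem derives_reductForm_of_rwStep (hmon : RWMonadic R)
    (hg : ∀ a, (g a).language = {l | (l, toWord a) ∈ R}) (s : Bool)
    {p z : Word A} (h : RWStep R p z) :
    (grammar g).Derives (reductForm g s (none :: z.map some))
      (reductForm g s (none :: p.map some)) := by
  obtain ⟨x, y, l, r, hlr, rfl, rfl⟩ := h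
  match r, (hmon _ hlr).2 with
  | [], _ =>
    have h₁ := derives_insert_none (g := g) s (List.cons_ne_nil none (x.map some)) (y.map some)
    have h₂ := derives_reductForm (derives_lhs hg s (a := none) hlr) (none :: x.map some)
      (y.map some)
    simpa using h₁.trans h₂
  | [b], _ =>
    have h₂ := derives_reductForm (derives_lhs hg s (a := some b) hlr) (none :: x.map some)
      (y.map some)
    simpa using h₂

theorem derives_terminals (s : Bool) (p : Word A) :
    (grammar g).Derives (reductForm g s (p.map some)) ((sideWord s p).map Symbol.terminal) := by
  have h : ∀ a : A, (grammar g).Derives [.nonterminal (.reducts s (some a))]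
      [.terminal (some (s, a))] := fun a => by
    simpa [toWord, sideWord, orient_singleton] using (Rule.leaf s (some a)).derives (g := g)
  induction p with
  | nil => simpa [reductForm, sideWord, orient_nil] using Derives.refl _
  | cons a p ih =>
    cases s
    · simpa [reductForm, sideWord, orient] using Derives.append (h a) ih
    · simpa [reductForm, sideWord, orient] using Derives.append ih (h a)

theorem derives_of_rwDerives (hmon : RWMonadic R)
    (hg : ∀ a, (g a).language = {l | (l, toWord a) ∈ R}) (s : Bool)
    {p z : Word A} (h : RWDerives R p z) :
    (grammar g).Derives (reductForm g s (none :: z.map some))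
      ((sideWord s p).map Symbol.terminal) := by
  have h₁ : (grammar g).Derives (reductForm g s (none :: z.map some))
      (reductForm g s (none :: p.map some)) := by
    induction h using Relation.ReflTransGen.head_induction_on with
    | refl => exact Derives.refl _
    | head hstep _ ih => exact ih.trans (derives_reductForm_of_rwStep hmon hg s hstep)
  have h₂ := derives_reductForm (g := g) (s := s) (u := [none]) (v := [])
    (by simpa [reductForm, orient_singleton, sideWord, toWord, orient_nil] using
      (Rule.leaf s none).derives (g := g)) [] (p.map some)
  exact h₁.trans ((by simpa using h₂ : (grammar g).Derives _ _).trans (derives_terminals s p))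

theorem derives_start (z : List (Option A)) :
    (grammar g).Derives [.nonterminal .start]
      (reductForm g false z ++ [.terminal none] ++ reductForm g true z) := by
  induction z with
  | nil => simpa [reductForm, orient] using (Rule.sep (g := g)).derives
  | cons a z ih =>
    exact (Rule.wrap a).derives.trans (ih.context [.nonterminal (.reducts false a)]
      [.nonterminal (.reducts true a)] (by simp) (by simp [reductForm, orient]))

end Complete

section Sound

variable (R : Set (Word A × Word A))

/-- The intended interpretation of the nonterminals. -/
def interp : PairNT g → Language (Option (Bool × A))
  | .start => commonReductLanguage R
  | .reducts s a => sideWord s '' {p | RWDerives R p (toWord a)}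
  | .inner s a n => sideWord s ''
      {p | ∃ l : Word A, (g a).Derives [.nonterminal n] (l.map Symbol.terminal) ∧ RWDerives R p l}

variable {R}

theorem exists_of_mem_sem_append {s : Bool} {F : PairNT g → Language (Option (Bool × A))}
    {u v : List (Symbol (Option (Bool × A)) (PairNT g))} {P Q : Word A → Prop}
    (hu : ∀ w ∈ sem F (orient s u), ∃ p, P p ∧ sideWord s p = w)
    (hv : ∀ w ∈ sem F (orient s v), ∃ p, Q p ∧ sideWord s p = w)
    {w : List (Option (Bool × A))} (hw : w ∈ sem F (orient s (u ++ v))) :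
    ∃ p q, P p ∧ Q q ∧ sideWord s (p ++ q) = w := by
  cases s
  · obtain ⟨x, hx, y, hy, rfl⟩ := (mem_sem_append F (s := u)).1 hw
    obtain ⟨p, hp, rfl⟩ := hu x hx
    obtain ⟨q, hq, rfl⟩ := hv y hy
    exact ⟨p, q, hp, hq, by simp [sideWord, orient]⟩
  · obtain ⟨x, hx, y, hy, rfl⟩ := (mem_sem_append F (s := v.reverse) (t := u.reverse)).1
      (by simpa [orient] using hw)
    obtain ⟨p, hp, rfl⟩ := hv x hx
    obtain ⟨q, hq, rfl⟩ := hu y hy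
    exact ⟨q, p, hq, hp, by simp [sideWord, orient]⟩

theorem exists_of_mem_sem_inner {s : Bool} {a : Option A} {u : List (Symbol A (g a).NT)}
    {w : List (Option (Bool × A))}
    (hw : w ∈ sem (interp (g := g) R) (orient s (u.map (innerSymbol s a)))) :
    ∃ p, (∃ l : Word A, (g a).Derives u (l.map Symbol.terminal) ∧ RWDerives R p l) ∧
      sideWord s p = w := by
  induction u generalizing w with
  | nil =>
    refine ⟨[], ⟨[], Derives.refl _, .refl⟩, ?_⟩
    simpa [orient_nil, mem_sem_nil, sideWord, eq_comm] using hw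
  | cons σ u ih =>
    obtain ⟨p, q, ⟨l, hl, hp⟩, ⟨m, hm, hq⟩, rfl⟩ := exists_of_mem_sem_append
      (u := [innerSymbol s a σ]) (v := u.map (innerSymbol s a))
      (P := fun p => ∃ l : Word A, (g a).Derives [σ] (l.map Symbol.terminal) ∧ RWDerives R p l)
      (by
        intro w hw
        rw [orient_singleton, mem_sem_singleton] at hw
        cases σ with
        | terminal b =>
          obtain ⟨p, hp, rfl⟩ := hw
          exact ⟨p, ⟨[b], Derives.refl _, hp⟩, rfl⟩
        | nonterminal n => exact hw)
      (fun w hw => ih hw) hw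
    exact ⟨p ++ q, ⟨l ++ m, by simpa using Derives.append hl hm, rwDerives_append hp hq⟩, rfl⟩

theorem interp_closed (hg : ∀ a, (g a).language = {l | (l, toWord a) ∈ R})
    {r : ContextFreeRule (Option (Bool × A)) (PairNT g)} (hr : Rule g r)
    {w : List (Option (Bool × A))} (hw : w ∈ sem (interp (g := g) R) r.output) :
    w ∈ interp (g := g) R r.input := by
  cases hr with
  | wrap a =>
    simp only [mem_sem_cons, mem_sem_nil] at hw
    obtain ⟨_, ⟨p, hp, rfl⟩, _, ⟨_, ⟨p', q', z, rfl, hp', hq'⟩, _,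
      ⟨_, ⟨q, hq, rfl⟩, _, rfl, rfl⟩, rfl⟩, rfl⟩ := hw
    exact ⟨p ++ p', q ++ q', toWord a ++ z, by simp [sideWord, orient], rwDerives_append hp hp',
      rwDerives_append hq hq'⟩
  | sep =>
    obtain rfl := (mem_sem_singleton _).1 hw
    exact ⟨[], [], [], by simp [sideWord, orient], .refl, .refl⟩
  | leaf s a =>
    obtain rfl := (mem_sem_map_terminal _).1 hw
    exact ⟨toWord a, .refl, rfl⟩
  | insert s a =>
    have h (b : Option A) : ∀ w ∈ sem (interp (g := g) R)
        (orient s [.nonterminal (.reducts s b)]),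
        ∃ p, RWDerives R p (toWord b) ∧ sideWord s p = w := by
      intro w hw
      rwa [orient_singleton, mem_sem_singleton] at hw
    obtain ⟨p, q, hp, hq, rfl⟩ := exists_of_mem_sem_append (h a) (h none) hw
    exact ⟨p ++ q, by simpa [toWord] using rwDerives_append hp hq, rfl⟩
  | enter s a =>
    obtain ⟨p, ⟨l, hl, hp⟩, rfl⟩ := (mem_sem_singleton _).1 hw
    have hl' : l ∈ (g a).language := hl
    rw [hg] at hl'
    exact ⟨p, hp.trans (rwDerives_of_mem hl'), rfl⟩
  | inner s a r hr =>
    obtain ⟨p, ⟨l, hl, hp⟩, rfl⟩ := exists_of_mem_sem_inner hw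
    exact ⟨p, ⟨l, (derives_of_mem_rules hr).trans hl, hp⟩, rfl⟩

end Sound

theorem language_grammar [Finite A] {R : Set (Word A × Word A)} (hmon : RWMonadic R)
    (hg : ∀ a, (g a).language = {l | (l, toWord a) ∈ R}) :
    (grammar g).language = commonReductLanguage R := by
  ext w
  constructor
  · intro hw
    exact (mem_sem_singleton _).1 (Derives.mem_sem (g := grammar g) (F := interp (g := g) R)
      (fun r hr w hw => interp_closed hg ((Set.Finite.mem_toFinset _).1 hr) hw) hw)
  · rintro ⟨p, q, z, rfl, hp, hq⟩
    rw [mem_language_iff]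
    have h := (Derives.append (derives_of_rwDerives hmon hg false hp)
      (Derives.refl [.terminal none])).append (derives_of_rwDerives hmon hg true hq)
    simpa using (derives_start (g := g) (none :: z.map some)).trans h

end PairNT

theorem isContextFree_commonReductLanguage {A : Type} [Finite A] {R : Set (Word A × Word A)}
    (hmon : RWMonadic R) (hcf : RWContextFree R) : (commonReductLanguage R).IsContextFree := by
  choose g hg using hcf
  exact ⟨_, PairNT.language_grammar hmon hg⟩

/-- Forgets the side of a letter. -/
def forgetSide {A : Type} : Option (Bool × A) → Hash A
  | none => .h2
  | some (_, a) => .letter a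

/-- Puts the first separator before a letter of the first word or before the second separator. -/
def markFirst {A : Type} : Option (Bool × A) → Option (List (Hash A))
  | none => some [.h1, .h2]
  | some (false, a) => some [.h1, .letter a]
  | some (true, _) => none

theorem map_forgetSide_sideWord {A : Type} (s : Bool) (p : Word A) :
    (sideWord s p).map forgetSide = orient s (p.map Hash.letter) := by
  simp [sideWord, map_orient, Function.comp_def, forgetSide]

theorem multTable_eq_pointedWords {A : Type} {R : Set (Word A × Word A)} (hconf : RWConfluent R) :
    multTable R =
      ContextFreeGrammar.pointedWords forgetSide markFirst (commonReductLanguage R) := by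
  ext w
  constructor
  · rintro ⟨u, v, w, rfl, h⟩
    obtain ⟨z, huv, hw⟩ := hconf.exists_of_monEq h
    cases v with
    | nil =>
      refine ⟨sideWord false u, none, sideWord true w, _, ⟨u, w, z, rfl, by simpa using huv, hw⟩,
        rfl, ?_⟩
      simp [map_forgetSide_sideWord, orient]
    | cons b v =>
      refine ⟨sideWord false u, some (false, b), sideWord false v ++ [none] ++ sideWord true w, _,
        ⟨u ++ b :: v, w, z, by simp [sideWord, orient], huv, hw⟩, rfl, ?_⟩
      simp [map_forgetSide_sideWord, orient, forgetSide]
  · rintro ⟨u, t, v, x, ⟨p, q, z, heq, hp, hq⟩, hx, rfl⟩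
    have hpq : MonEq R p q := hconf.monEq_iff.2 ⟨z, hp, hq⟩
    rw [List.append_assoc, List.append_assoc, List.singleton_append, eq_comm] at heq
    rcases List.append_eq_append_cons_cases heq with ⟨c, rfl, hc⟩ | ⟨c, hc, rfl⟩
    · rcases c with _ | ⟨τ, c⟩
      · simp only [List.nil_append, List.singleton_append, List.cons.injEq] at hc
        obtain ⟨rfl, rfl⟩ := hc
        cases hx
        exact ⟨p, [], q, by simp [map_forgetSide_sideWord, orient], by simpa using hpq⟩
      · have ht : t ∈ sideWord true q := by
          simp only [List.cons_append, List.nil_append, List.cons.injEq] at hc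
          simp [hc.2]
        obtain ⟨a, -, rfl⟩ : ∃ a ∈ q, some (true, a) = t := by
          simpa [sideWord, orient] using ht
        cases hx
    · simp only [sideWord, orient, Bool.false_eq_true, if_false, List.map_eq_append_iff,
        List.map_eq_cons_iff] at hc
      obtain ⟨p₁, _, rfl, rfl, b, p₂, rfl, rfl, rfl⟩ := hc
      cases hx
      refine ⟨p₁, b :: p₂, q, ?_, hpq⟩
      simp [forgetSide, Function.comp_def, map_forgetSide_sideWord, orient]

/-- **Theorem 3.1.** If `(A,R)` is a confluent context-free monadic rewriting system,
then `(A*, M(A*))` is a word-hyperbolic structure for the monoid presented by `⟨A | R⟩`;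
that is, the language `M(A*)` is context-free. -/
theorem multiplication_language_contextFree_of_confluent_contextFree_monadic
    {A : Type} [Fintype A] (R : Set (Word A × Word A))
    (hconf : RWConfluent R) (hmon : RWMonadic R) (hcf : RWContextFree R) :
    Language.IsContextFree (multTable R) := by
  rw [multTable_eq_pointedWords hconf]
  exact (isContextFree_commonReductLanguage hmon hcf).pointedWords forgetSide markFirst
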